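/- Fix integers s, h ≥ 1, m ≥ 1, n ≥ 1, and define G⁻ : ℤ^m → ℤ^m by G⁻(r̃)_1 = r̃_1 and, for 2 ≤ i ≤ m, G⁻(r̃)_i = r̃_i − 1 if r̃_{i−1} − h > s and G⁻(r̃)_i = r̃_i otherwise. Then: (i) G⁻ is injective on all of ℤ^m; (ii) G⁻ maps Good_{m,n,h} into Good_{m,n,h−1}; and (iii) for every r̃ ∈ Good_{m,n,h} there exists an index j ∈ {2,…,m+1} such that r̃_i − G⁻(r̃)_i = 1 for all i ≥ j and r̃_i − G⁻(r̃)_i = 0 for all i < j. -/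

import Mathlib

/-- `Good m n h` is the set of vectors `(r_1, …, r_m) ∈ ℤ^m` (zero-indexed as
`Fin m → ℤ`) with `h ≤ r_1`, `r_{i-1} + 2h ≤ r_i` for `2 ≤ i ≤ m` and `r_m ≤ n - h`. -/
def Good (m : ℕ) (n h : ℤ) : Set (Fin m → ℤ) :=
  { r | (∀ i : Fin m, (i : ℕ) = 0 → h ≤ r i) ∧
        (∀ i j : Fin m, (i : ℕ) + 1 = (j : ℕ) → r i + 2 * h ≤ r j) ∧
        (∀ i : Fin m, (i : ℕ) = m - 1 → r i ≤ n - h) }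

theorem stmt_4 (s h : ℤ) (hs : 1 ≤ s) (hh : 1 ≤ h) (m : ℕ) (hm : 1 ≤ m)
    (n : ℤ) (hn : 1 ≤ n)
    (Gm : (Fin m → ℤ) → (Fin m → ℤ))
    (hGm₀ : ∀ r : Fin m → ℤ, ∀ i : Fin m, (i : ℕ) = 0 → Gm r i = r i)
    (hGm₁ : ∀ r : Fin m → ℤ, ∀ i j : Fin m, (j : ℕ) + 1 = (i : ℕ) →
      Gm r i = if s < r j - h then r i - 1 else r i) :
    Function.Injective Gm ∧
    Set.MapsTo Gm (Good m n h) (Good m n (h - 1)) ∧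
    ∀ r ∈ Good m n h, ∃ j : ℕ, 2 ≤ j ∧ j ≤ m + 1 ∧ ∀ i : Fin m,
      (j ≤ (i : ℕ) + 1 → r i - Gm r i = 1) ∧ ((i : ℕ) + 1 < j → r i - Gm r i = 0) := by
  have hb : ∀ r : Fin m → ℤ, ∀ i : Fin m, Gm r i ≤ r i ∧ r i - 1 ≤ Gm r i := by
    intro r i
    rcases Nat.eq_zero_or_pos (i : ℕ) with h0 | h0
    · rw [hGm₀ r i h0]; omega
    · have hi := i.isLt
      rw [hGm₁ r i ⟨i - 1, by omega⟩ (by simp only; omega)]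
      split_ifs <;> omega
  refine ⟨?_, ?_, ?_⟩
  · intro a b hab
    have key : ∀ k : ℕ, ∀ hk : k < m, a ⟨k, hk⟩ = b ⟨k, hk⟩ := by
      intro k
      induction k with
      | zero =>
        intro hk
        have := congrFun hab ⟨0, hk⟩
        rwa [hGm₀ a _ rfl, hGm₀ b _ rfl] at this
      | succ k ih =>
        intro hk
        have := congrFun hab ⟨k + 1, hk⟩
        rw [hGm₁ a _ ⟨k, by omega⟩ rfl, hGm₁ b _ ⟨k, by omega⟩ rfl, ih (by omega)] at this
        split_ifs at this <;> omega
    funext i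
    exact key i i.isLt
  · rintro r ⟨h1, h2, h3⟩
    refine ⟨?_, ?_, ?_⟩
    · intro i hi
      rw [hGm₀ r i hi]
      have := h1 i hi
      omega
    · intro i j hij
      have := h2 i j hij
      have := hb r i
      have := hb r j
      omega
    · intro i hi
      have := h3 i hi
      have := hb r i
      omega
  · rintro r ⟨h1, h2, h3⟩
    have mono : ∀ d k : ℕ, ∀ hk : k + d < m, r ⟨k, by omega⟩ ≤ r ⟨k + d, hk⟩ := by
      intro d
      induction d with
      | zero => intro k hk; exact le_refl _
      | succ d ih =>
        intro k hk
        have e1 := ih k (by omega)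
        have e2 := h2 ⟨k + d, by omega⟩ ⟨k + (d + 1), hk⟩ (by simp only; omega)
        omega
    classical
    have hex : ∃ k : ℕ, 2 ≤ k ∧ (m + 1 ≤ k ∨ ∃ p : Fin m, (p : ℕ) + 2 = k ∧ s < r p - h) :=
      ⟨m + 1, by omega, Or.inl le_rfl⟩
    obtain ⟨hj2, hj⟩ := Nat.find_spec hex
    refine ⟨Nat.find hex, hj2, Nat.find_min' hex ⟨by omega, Or.inl le_rfl⟩, ?_⟩
    intro i
    have hi := i.isLt
    constructor
    · intro hji
      rcases hj with hj | ⟨p, hp, hps⟩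
      · omega
      · have hm1 := mono (i - 1 - p) p (by omega)
        have e : (⟨(p : ℕ) + (i - 1 - p), by omega⟩ : Fin m) = ⟨i - 1, by omega⟩ :=
          Fin.ext (by simp only; omega)
        rw [e] at hm1
        simp only [Fin.eta] at hm1
        rw [hGm₁ r i ⟨i - 1, by omega⟩ (by simp only; omega), if_pos (by omega)]
        omega
    · intro hij
      rcases Nat.eq_zero_or_pos (i : ℕ) with h0 | h0
      · rw [hGm₀ r i h0]; omega
      · have hn := Nat.find_min hex hij
        rw [hGm₁ r i ⟨i - 1, by omega⟩ (by simp only; omega), if_neg]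
        · omega
        · intro hlt
          exact hn ⟨by omega, Or.inr ⟨⟨i - 1, by omega⟩, by simp only; omega, hlt⟩⟩
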